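/- Name introduction removal: if a surface-syntax type t translates to t' under the surface-to-internal translation judgement t ▸‣ t', then t' contains no occurrence of the name introduction construct (x : t). -/

import Mathlib

/-!
# Mezzo surface syntax: kinding and translation to the internal syntax

We formalize the (combined surface/internal) syntax of Mezzo types, the
collection `BV` of names introduced by a type (non-lexical binders), the
kind-checking relation `Γ, s ⊢ t : κ` (where the side `s` records whether we
are in the left-hand side of an external arrow, where `consumes` is
permitted), its variant `Γ ⊢▸ t : κ` which first extends `Γ` with `BV t` and
sets the side to `right`, and the surface-to-internal translation relations
`t ▸ t'` (`Tr`) and `t ▸‣ t'` (`TrX`, which wraps the result in existential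
quantifiers for `BV t`).  The translation eliminates name introductions
`(x : t)`, `consumes` annotations, and the external arrow `⇝`.

The theorem states that the translation removes all name introductions:
if `t ▸‣ t'` then `t'` contains no name introduction construct.
-/

namespace MezzoSurface

abbrev Name := String

/-- Kinds: `term`, `type`, `perm`, and arrow kinds for data types. -/
inductive Kind : Type where
  | term : Kind
  | typ : Kind
  | perm : Kind
  | arrow : List Kind → Kind → Kind

/-- A kinding environment: a list of name/kind pairs (new names first, with
masking). -/
abbrev Env := List (Name × Kind)

/-- Which side of an external arrow we are on (`consumes` is only permitted
on the left). -/
inductive Side : Type where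
  | left : Side
  | right : Side

/-- Mezzo types and permissions, surface and internal constructs combined.
Surface-only constructs: the external arrow `⇝` (`earrow`), the name
introduction `(x : t)` (`nameIntro`) and the `consumes` annotation.
The internal arrow `iarrow` is internal-only. -/
inductive STy : Type where
  | var : Name → STy
  | dynamic : STy
  | unknown : STy                                -- the top type
  | iarrow : STy → STy → STy                     -- internal arrow t → u
  | earrow : STy → STy → STy                     -- external arrow t ⇝ u
  | tuple : List STy → STy
  | concrete : Name → List (Name × STy) → STy    -- A { f : t; … }
  | forall_ : Name → Kind → STy → STy
  | exists_ : Name → Kind → STy → STy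
  | app : STy → List STy → STy
  | nameIntro : Name → STy → STy                 -- (x : t)
  | consumes : STy → STy
  | bar : STy → STy → STy                        -- (t | P)
  | singleton : Name → STy                       -- =x
  | empty : STy
  | star : STy → STy → STy
  | anchored : Name → STy → STy                  -- x @ t

mutual
/-- `BV t`: the names introduced by `t`, collected through transparent
constructs (tuples, concrete types, `(t | P)`, `consumes`) and stopping at
opaque constructs (quantifiers, arrows, applications, …). -/
def BV : STy → Env
  | .nameIntro x _ => [(x, .term)]
  | .tuple ts => BVList ts
  | .concrete _ fs => BVFields fs
  | .bar t _ => BV t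
  | .consumes t => BV t
  | _ => []

def BVList : List STy → Env
  | [] => []
  | t :: ts => BV t ++ BVList ts

def BVFields : List (Name × STy) → Env
  | [] => []
  | (_, t) :: fs => BV t ++ BVFields fs
end

/-- The kind-checking relation `Γ, s ⊢ t : κ`.  The premises written
`WK (BV t ++ Γ) .right t κ` are the variant judgement `Γ ⊢▸ t : κ`. -/
inductive WK : Env → Side → STy → Kind → Prop where
  | var {Γ : Env} {s : Side} {x : Name} {κ : Kind} :
      Γ.lookup x = some κ → WK Γ s (.var x) κ
  | dynamic {Γ : Env} {s : Side} : WK Γ s .dynamic .typ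
  | unknown {Γ : Env} {s : Side} : WK Γ s .unknown .typ
  | iarrow {Γ : Env} {s : Side} {t₁ t₂ : STy} :
      WK Γ .right t₁ .typ → WK Γ .right t₂ .typ →
      WK Γ s (.iarrow t₁ t₂) .typ
  | earrow {Γ : Env} {s : Side} {t₁ t₂ : STy} :
      WK (BV t₁ ++ Γ) .left t₁ .typ →
      WK (BV t₂ ++ (BV t₁ ++ Γ)) .right t₂ .typ →
      WK Γ s (.earrow t₁ t₂) .typ
  | tuple {Γ : Env} {s : Side} {ts : List STy} :
      (∀ t ∈ ts, WK Γ s t .typ) → WK Γ s (.tuple ts) .typ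
  | concrete {Γ : Env} {s : Side} {A : Name} {fs : List (Name × STy)} :
      (∀ f ∈ fs, WK Γ s f.2 .typ) → WK Γ s (.concrete A fs) .typ
  | forall_ {Γ : Env} {s : Side} {x : Name} {κ' κ : Kind} {t : STy} :
      WK (BV t ++ ((x, κ') :: Γ)) .right t κ →
      WK Γ s (.forall_ x κ' t) κ
  | exists_ {Γ : Env} {s : Side} {x : Name} {κ' κ : Kind} {t : STy} :
      WK (BV t ++ ((x, κ') :: Γ)) .right t κ →
      WK Γ s (.exists_ x κ' t) κ
  | app {Γ : Env} {s : Side} {t : STy} {ts : List STy} {κs : List Kind} {κ : Kind} :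
      WK (BV t ++ Γ) .right t (.arrow κs κ) →
      ts.length = κs.length →
      (∀ p ∈ ts.zip κs, WK (BV p.1 ++ Γ) .right p.1 p.2) →
      WK Γ s (.app t ts) κ
  | nameIntro {Γ : Env} {s : Side} {x : Name} {t : STy} :
      Γ.lookup x = some .term → WK Γ s t .typ →
      WK Γ s (.nameIntro x t) .typ
  | consumes {Γ : Env} {t : STy} {κ : Kind} :
      WK Γ .right t κ → (κ = .typ ∨ κ = .perm) →
      WK Γ .left (.consumes t) κ
  | bar {Γ : Env} {s : Side} {t p : STy} :
      WK Γ s t .typ → WK Γ s p .perm → WK Γ s (.bar t p) .typ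
  | singleton {Γ : Env} {s : Side} {x : Name} :
      Γ.lookup x = some .term → WK Γ s (.singleton x) .typ
  | empty {Γ : Env} {s : Side} : WK Γ s .empty .perm
  | star {Γ : Env} {s : Side} {p q : STy} :
      WK Γ s p .perm → WK Γ s q .perm → WK Γ s (.star p q) .perm
  | anchored {Γ : Env} {s : Side} {x : Name} {t : STy} :
      Γ.lookup x = some .term → WK (BV t ++ Γ) .right t .typ →
      WK Γ s (.anchored x t) .perm

/-- The variant judgement `Γ ⊢▸ t : κ`: extend `Γ` with `BV t` and set the
side to `right`. -/
def WKx (Γ : Env) (t : STy) (κ : Kind) : Prop :=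
  WK (BV t ++ Γ) .right t κ

/-- Wrap a type in existential quantifiers for an environment. -/
def existsMany : Env → STy → STy
  | [], t => t
  | (x, κ) :: Γ, t => .exists_ x κ (existsMany Γ t)

/-- Wrap a type in universal quantifiers for an environment. -/
def forallMany : Env → STy → STy
  | [], t => t
  | (x, κ) :: Γ, t => .forall_ x κ (forallMany Γ t)

mutual
/-- `[τ / consumes τ] t`: erase all `consumes` annotations. -/
def eraseC : STy → STy
  | .var x => .var x
  | .dynamic => .dynamic
  | .unknown => .unknown
  | .iarrow a b => .iarrow (eraseC a) (eraseC b)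
  | .earrow a b => .earrow (eraseC a) (eraseC b)
  | .tuple ts => .tuple (eraseCL ts)
  | .concrete A fs => .concrete A (eraseCF fs)
  | .forall_ x κ t => .forall_ x κ (eraseC t)
  | .exists_ x κ t => .exists_ x κ (eraseC t)
  | .app t ts => .app (eraseC t) (eraseCL ts)
  | .nameIntro x t => .nameIntro x (eraseC t)
  | .consumes t => eraseC t
  | .bar t p => .bar (eraseC t) (eraseC p)
  | .singleton x => .singleton x
  | .empty => .empty
  | .star p q => .star (eraseC p) (eraseC q)
  | .anchored x t => .anchored x (eraseC t)

def eraseCL : List STy → List STy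
  | [] => []
  | t :: ts => eraseC t :: eraseCL ts

def eraseCF : List (Name × STy) → List (Name × STy)
  | [] => []
  | (f, t) :: fs => (f, eraseC t) :: eraseCF fs
end

/-- Is this type syntactically a permission (kind `perm`)?  Used to choose
the appropriate top element (`empty` versus `unknown`). -/
def permLike : STy → Bool
  | .empty => true
  | .star _ _ => true
  | .anchored _ _ => true
  | .consumes t => permLike t
  | _ => false

mutual
/-- `[⊤ / consumes τ] t`: replace every component marked `consumes` with the
top element (`unknown` for a type, `empty` for a permission). -/
def topC : STy → STy
  | .var x => .var x
  | .dynamic => .dynamic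
  | .unknown => .unknown
  | .iarrow a b => .iarrow (topC a) (topC b)
  | .earrow a b => .earrow (topC a) (topC b)
  | .tuple ts => .tuple (topCL ts)
  | .concrete A fs => .concrete A (topCF fs)
  | .forall_ x κ t => .forall_ x κ (topC t)
  | .exists_ x κ t => .exists_ x κ (topC t)
  | .app t ts => .app (topC t) (topCL ts)
  | .nameIntro x t => .nameIntro x (topC t)
  | .consumes t => if permLike t then .empty else .unknown
  | .bar t p => .bar (topC t) (topC p)
  | .singleton x => .singleton x
  | .empty => .empty
  | .star p q => .star (topC p) (topC q)
  | .anchored x t => .anchored x (topC t)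

def topCL : List STy → List STy
  | [] => []
  | t :: ts => topC t :: topCL ts

def topCF : List (Name × STy) → List (Name × STy)
  | [] => []
  | (f, t) :: fs => (f, topC t) :: topCF fs
end

mutual
/-- The surface-to-internal translation `t ▸ t'`. -/
inductive Tr : STy → STy → Prop where
  | var {x : Name} : Tr (.var x) (.var x)
  | dynamic : Tr .dynamic .dynamic
  | unknown : Tr .unknown .unknown
  | tuple {ts ts' : List STy} :
      ts.length = ts'.length → (∀ p ∈ ts.zip ts', Tr p.1 p.2) →
      Tr (.tuple ts) (.tuple ts')
  | concrete {A : Name} {fs fs' : List (Name × STy)} :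
      fs.length = fs'.length →
      (∀ p ∈ fs.zip fs', p.1.1 = p.2.1) →
      (∀ p ∈ fs.zip fs', Tr p.1.2 p.2.2) →
      Tr (.concrete A fs) (.concrete A fs')
  | app {t t' : STy} {ts ts' : List STy} :
      TrX t t' → ts.length = ts'.length → (∀ p ∈ ts.zip ts', TrX p.1 p.2) →
      Tr (.app t ts) (.app t' ts')
  | nameIntro {x : Name} {t t' : STy} :
      Tr t t' →
      Tr (.nameIntro x t) (.bar (.singleton x) (.anchored x t'))
  | consumes {t t' : STy} : Tr t t' → Tr (.consumes t) (.consumes t')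
  | forall_ {x : Name} {κ : Kind} {t t' : STy} :
      TrX t t' → Tr (.forall_ x κ t) (.forall_ x κ t')
  | exists_ {x : Name} {κ : Kind} {t t' : STy} :
      TrX t t' → Tr (.exists_ x κ t) (.exists_ x κ t')
  | bar {t t' p p' : STy} : Tr t t' → Tr p p' → Tr (.bar t p) (.bar t' p')
  | singleton {x : Name} : Tr (.singleton x) (.singleton x)
  | empty : Tr .empty .empty
  | star {p p' q q' : STy} : Tr p p' → Tr q q' → Tr (.star p q) (.star p' q')
  | anchored {x : Name} {t t' : STy} : TrX t t' → Tr (.anchored x t) (.anchored x t')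
  | iarrow {t₁ t₁' t₂ t₂' : STy} :
      TrX t₁ t₁' → TrX t₂ t₂' → Tr (.iarrow t₁ t₂) (.iarrow t₁' t₂')
  | earrow {t₁ t₁' t₂ t₂' : STy} {r : Name} :
      Tr t₁ t₁' → TrX t₂ t₂' →
      r ∉ (BV t₁).map Prod.fst →
      Tr (.earrow t₁ t₂)
         (forallMany (BV t₁) (.forall_ r .term
           (.iarrow (.bar (.singleton r) (.anchored r (eraseC t₁')))
                    (.bar t₂' (.anchored r (topC t₁'))))))

/-- The translation `t ▸‣ t'`: translate and wrap in existential quantifiers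
for the names `BV t` introduced by `t`. -/
inductive TrX : STy → STy → Prop where
  | mk {t t' : STy} : Tr t t' → TrX t (existsMany (BV t) t')
end

/-- The type contains no occurrence of the name introduction construct
`(x : t)`. -/
inductive NIFree : STy → Prop where
  | var {x : Name} : NIFree (.var x)
  | dynamic : NIFree .dynamic
  | unknown : NIFree .unknown
  | iarrow {a b : STy} : NIFree a → NIFree b → NIFree (.iarrow a b)
  | earrow {a b : STy} : NIFree a → NIFree b → NIFree (.earrow a b)
  | tuple {ts : List STy} : (∀ t ∈ ts, NIFree t) → NIFree (.tuple ts)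
  | concrete {A : Name} {fs : List (Name × STy)} :
      (∀ f ∈ fs, NIFree f.2) → NIFree (.concrete A fs)
  | forall_ {x : Name} {κ : Kind} {t : STy} : NIFree t → NIFree (.forall_ x κ t)
  | exists_ {x : Name} {κ : Kind} {t : STy} : NIFree t → NIFree (.exists_ x κ t)
  | app {t : STy} {ts : List STy} :
      NIFree t → (∀ u ∈ ts, NIFree u) → NIFree (.app t ts)
  | consumes {t : STy} : NIFree t → NIFree (.consumes t)
  | bar {t p : STy} : NIFree t → NIFree p → NIFree (.bar t p)
  | singleton {x : Name} : NIFree (.singleton x)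
  | empty : NIFree .empty
  | star {p q : STy} : NIFree p → NIFree q → NIFree (.star p q)
  | anchored {x : Name} {t : STy} : NIFree t → NIFree (.anchored x t)

theorem eraseCL_eq (ts : List STy) : eraseCL ts = ts.map eraseC := by
  induction ts with
  | nil => simp [eraseCL]
  | cons t ts ih => simp [eraseCL, ih]

theorem eraseCF_eq (fs : List (Name × STy)) :
    eraseCF fs = fs.map (fun f => (f.1, eraseC f.2)) := by
  induction fs with
  | nil => simp [eraseCF]
  | cons t ts ih => simp [eraseCF, ih]

theorem topCL_eq (ts : List STy) : topCL ts = ts.map topC := by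
  induction ts with
  | nil => simp [topCL]
  | cons t ts ih => simp [topCL, ih]

theorem topCF_eq (fs : List (Name × STy)) :
    topCF fs = fs.map (fun f => (f.1, topC f.2)) := by
  induction fs with
  | nil => simp [topCF]
  | cons t ts ih => simp [topCF, ih]

theorem NIFree.erase {t : STy} (h : NIFree t) : NIFree (eraseC t) := by
  induction h with
  | tuple _ ih =>
    rw [eraseC, eraseCL_eq]
    refine .tuple fun u hu => ?_
    obtain ⟨v, hv, rfl⟩ := List.mem_map.1 hu
    exact ih v hv
  | concrete _ ih =>
    rw [eraseC, eraseCF_eq]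
    refine .concrete fun u hu => ?_
    obtain ⟨v, hv, rfl⟩ := List.mem_map.1 hu
    exact ih v hv
  | app _ _ ih1 ih =>
    rw [eraseC, eraseCL_eq]
    refine .app ih1 fun u hu => ?_
    obtain ⟨v, hv, rfl⟩ := List.mem_map.1 hu
    exact ih v hv
  | consumes _ ih => rw [eraseC]; exact ih
  | _ => rw [eraseC]; constructor <;> assumption

theorem NIFree.top {t : STy} (h : NIFree t) : NIFree (topC t) := by
  induction h with
  | tuple _ ih =>
    rw [topC, topCL_eq]
    refine .tuple fun u hu => ?_
    obtain ⟨v, hv, rfl⟩ := List.mem_map.1 hu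
    exact ih v hv
  | concrete _ ih =>
    rw [topC, topCF_eq]
    refine .concrete fun u hu => ?_
    obtain ⟨v, hv, rfl⟩ := List.mem_map.1 hu
    exact ih v hv
  | app _ _ ih1 ih =>
    rw [topC, topCL_eq]
    refine .app ih1 fun u hu => ?_
    obtain ⟨v, hv, rfl⟩ := List.mem_map.1 hu
    exact ih v hv
  | consumes _ ih =>
    rw [topC]
    split
    · exact .empty
    · exact .unknown
  | _ => rw [topC]; constructor <;> assumption

theorem NIFree.existsMany {t : STy} (h : NIFree t) (Γ : Env) :
    NIFree (existsMany Γ t) := by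
  induction Γ with
  | nil => exact h
  | cons a Γ ih => exact .exists_ ih

theorem NIFree.forallMany {t : STy} (h : NIFree t) (Γ : Env) :
    NIFree (forallMany Γ t) := by
  induction Γ with
  | nil => exact h
  | cons a Γ ih => exact .forall_ ih

theorem exists_zip_of_mem {α β : Type} {l : List α} {l' : List β}
    (h : l.length = l'.length) {b : β} (hb : b ∈ l') : ∃ a, (a, b) ∈ l.zip l' := by
  obtain ⟨i, hi, rfl⟩ := List.getElem_of_mem hb
  refine ⟨l[i]'(h ▸ hi), ?_⟩
  rw [← List.getElem_zip (h := by simp [h, hi])]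
  exact List.getElem_mem _

theorem TrX.niFree {t t' : STy} (htr : TrX t t') : NIFree t' := by
  induction htr using TrX.rec (motive_1 := fun _ t' _ => NIFree t') with
  | mk _ ih => exact ih.existsMany _
  | tuple hl _ ih =>
    refine .tuple fun u hu => ?_
    obtain ⟨a, ha⟩ := exists_zip_of_mem hl hu
    exact ih _ ha
  | concrete hl _ _ ih =>
    refine .concrete fun u hu => ?_
    obtain ⟨a, ha⟩ := exists_zip_of_mem hl hu
    exact ih _ ha
  | app _ hl _ ih1 ih =>
    refine .app ih1 fun u hu => ?_
    obtain ⟨a, ha⟩ := exists_zip_of_mem hl hu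
    exact ih _ ha
  | nameIntro _ ih => exact .bar .singleton (.anchored ih)
  | earrow _ _ _ ih1 ih2 =>
    exact NIFree.forallMany (.forall_ (.iarrow (.bar .singleton (.anchored ih1.erase))
      (.bar ih2 (.anchored ih1.top)))) _
  | _ => constructor <;> assumption

/-- **Name introduction removal**: if a surface-syntax type `t` translates to
`t'` under the surface-to-internal translation judgement `t ▸‣ t'`, then `t'`
contains no occurrence of the name introduction construct `(x : t)`. -/
theorem name_introduction_removal {t t' : STy} (htr : TrX t t') :
    NIFree t' := by
  exact htr.niFree

end MezzoSurface
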